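/- Let p ∈ [1,∞) and let d_M : M*_c(ℝ^n) × M*_c(ℝ^n) → [0,∞) be a metric satisfying hypotheses (i) and (ii) of the previous theorem (fiber condition d_M(m·μ₁, m·μ₂) = f(m)·W_p(μ₁,μ₂) for some f : (0,∞) → (0,∞), and the uniform local mass-change bound over an unbounded set Σ ⊆ ℝ^n of Dirac base points). Then there exists no metric d_{M₀} on M_c(ℝ^n) = {0} ∪ M*_c(ℝ^n) that agrees with d_M on M*_c(ℝ^n) and satisfies either (a) sup_{x∈Σ} d_{M₀}(0, m₀·δ_x) < +∞ for some m₀ > 0, or (b) lim_{m→0⁺} d_{M₀}(0, m·μ_i) = 0 for at least two distinct probability measures μ₁ ≠ μ₂ ∈ P_c(ℝ^n). Here 0 denotes the zero measure. -/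

import Mathlib

open MeasureTheory ENNReal

/-- The `p`-Wasserstein distance between two (probability) measures on `ℝⁿ`:
`W_p(μ,ν) = (inf_π ∫ |x-y|^p dπ)^{1/p}`, the infimum running over all couplings of `μ` and `ν`. -/
noncomputable def Wp (n : ℕ) (p : ℝ)
    (μ ν : Measure (EuclideanSpace ℝ (Fin n))) : ℝ :=
  ((sInf {c : ℝ≥0∞ | ∃ π : Measure (EuclideanSpace ℝ (Fin n) × EuclideanSpace ℝ (Fin n)),
      π.map Prod.fst = μ ∧ π.map Prod.snd = ν ∧
      c = ∫⁻ q, edist q.1 q.2 ^ p ∂π}) ^ (1 / p)).toReal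

/-- `μ` has compact support. -/
def CompactSupp {n : ℕ} (μ : Measure (EuclideanSpace ℝ (Fin n))) : Prop :=
  ∃ K : Set (EuclideanSpace ℝ (Fin n)), IsCompact K ∧ μ Kᶜ = 0

/-- `μ ∈ M*_c(ℝⁿ)`: compactly supported, with positive finite mass. -/
def IsMcStar {n : ℕ} (μ : Measure (EuclideanSpace ℝ (Fin n))) : Prop :=
  CompactSupp μ ∧ μ Set.univ ≠ 0 ∧ μ Set.univ ≠ ⊤

/-- `μ ∈ P_c(ℝⁿ)`: compactly supported probability measure. -/
def IsPc {n : ℕ} (μ : Measure (EuclideanSpace ℝ (Fin n))) : Prop :=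
  CompactSupp μ ∧ μ Set.univ = 1

/-- `μ ∈ M_c(ℝⁿ)`: compactly supported, with finite mass (possibly the zero measure). -/
def IsMc {n : ℕ} (μ : Measure (EuclideanSpace ℝ (Fin n))) : Prop :=
  CompactSupp μ ∧ μ Set.univ ≠ ⊤


lemma Wp_dirac {n : ℕ} {p : ℝ} (hp : 1 ≤ p) (x y : EuclideanSpace ℝ (Fin n)) :
    Wp n p (Measure.dirac x) (Measure.dirac y) = dist x y := by
  have key : {c : ℝ≥0∞ | ∃ π : Measure (EuclideanSpace ℝ (Fin n) × EuclideanSpace ℝ (Fin n)),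
      π.map Prod.fst = Measure.dirac x ∧ π.map Prod.snd = Measure.dirac y ∧
      c = ∫⁻ q, edist q.1 q.2 ^ p ∂π} = {edist x y ^ p} := by
    ext c
    simp only [Set.mem_ofPred_eq, Set.mem_singleton_iff]
    constructor
    · rintro ⟨π, h1, h2, rfl⟩
      have e1 : ∀ᵐ q ∂π, q.1 = x := by
        have : ∀ᵐ z ∂(π.map Prod.fst), z = x := by
          rw [h1, ae_dirac_eq]; simp
        exact ae_of_ae_map measurable_fst.aemeasurable this
      have e2 : ∀ᵐ q ∂π, q.2 = y := by
        have : ∀ᵐ z ∂(π.map Prod.snd), z = y := by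
          rw [h2, ae_dirac_eq]; simp
        exact ae_of_ae_map measurable_snd.aemeasurable this
      have hu : π Set.univ = 1 := by
        have := congrArg (fun μ => μ Set.univ) h1
        simpa [Measure.map_apply measurable_fst MeasurableSet.univ] using this
      have : ∫⁻ q, edist q.1 q.2 ^ p ∂π = ∫⁻ q, edist x y ^ p ∂π := by
        apply lintegral_congr_ae
        filter_upwards [e1, e2] with q h h'
        rw [h, h']
      rw [this, lintegral_const, hu, mul_one]
    · rintro rfl
      refine ⟨Measure.dirac (x, y), ?_, ?_, ?_⟩
      · rw [Measure.map_dirac' measurable_fst]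
      · rw [Measure.map_dirac' measurable_snd]
      · rw [lintegral_dirac]
  have hp0 : p ≠ 0 := by linarith
  unfold Wp
  rw [key, sInf_singleton, ← ENNReal.rpow_mul, mul_one_div_cancel hp0, ENNReal.rpow_one,
    edist_dist, ENNReal.toReal_ofReal dist_nonneg]

lemma isPc_dirac {n : ℕ} (x : EuclideanSpace ℝ (Fin n)) : IsPc (Measure.dirac x) :=
  ⟨⟨{x}, isCompact_singleton, by simp⟩, by simp⟩

lemma IsPc.star {n : ℕ} {μ : Measure (EuclideanSpace ℝ (Fin n))} (h : IsPc μ) {m : ℝ}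
    (hm : 0 < m) : IsMcStar (ENNReal.ofReal m • μ) := by
  obtain ⟨⟨K, hK, h0⟩, h1⟩ := h
  refine ⟨⟨K, hK, by simp [h0]⟩, ?_, ?_⟩
  · simp [h1, hm]
  · simp [h1]

lemma IsMcStar.mc {n : ℕ} {μ : Measure (EuclideanSpace ℝ (Fin n))} (h : IsMcStar μ) : IsMc μ :=
  ⟨h.1, h.2.2⟩

lemma isMc_zero {n : ℕ} : IsMc (0 : Measure (EuclideanSpace ℝ (Fin n))) :=
  ⟨⟨∅, isCompact_empty, by simp⟩, by simp⟩

theorem statement1 (n : ℕ) (p : ℝ) (hp : 1 ≤ p)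
    (dM : Measure (EuclideanSpace ℝ (Fin n)) → Measure (EuclideanSpace ℝ (Fin n)) → ℝ)
    -- `dM` is a distance function on `M*_c(ℝⁿ)`
    (hnonneg : ∀ μ ν, IsMcStar μ → IsMcStar ν → 0 ≤ dM μ ν)
    (heq : ∀ μ ν, IsMcStar μ → IsMcStar ν → (dM μ ν = 0 ↔ μ = ν))
    (hsymm : ∀ μ ν, IsMcStar μ → IsMcStar ν → dM μ ν = dM ν μ)
    (htri : ∀ μ ν ρ, IsMcStar μ → IsMcStar ν → IsMcStar ρ → dM μ ρ ≤ dM μ ν + dM ν ρ)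
    -- (i) fiber condition: `dM(m μ₁, m μ₂) = f(m) W_p(μ₁, μ₂)`
    (f : ℝ → ℝ) (hf : ∀ m : ℝ, 0 < m → 0 < f m)
    (hfiber : ∀ m : ℝ, 0 < m → ∀ μ₁ μ₂, IsPc μ₁ → IsPc μ₂ →
      dM (ENNReal.ofReal m • μ₁) (ENNReal.ofReal m • μ₂) = f m * Wp n p μ₁ μ₂)
    -- (ii) uniform local mass-change bound over an unbounded set `S` of Dirac base points
    (S : Set (EuclideanSpace ℝ (Fin n))) (hS : ¬ Bornology.IsBounded S)
    (hii : ∀ m₀ : ℝ, 0 < m₀ → ∃ r > (0 : ℝ), ∃ C > (0 : ℝ), ∀ m : ℝ, 0 < m →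
      m ∈ Set.Ioo (m₀ - r) (m₀ + r) → ∀ x ∈ S,
      dM (ENNReal.ofReal m₀ • Measure.dirac x) (ENNReal.ofReal m • Measure.dirac x) ≤ C) :
    -- there is no metric `d0` on `M_c(ℝⁿ)` extending `dM` with either property (a) or (b)
    ¬ ∃ d0 : Measure (EuclideanSpace ℝ (Fin n)) → Measure (EuclideanSpace ℝ (Fin n)) → ℝ,
      (∀ μ ν, IsMc μ → IsMc ν → 0 ≤ d0 μ ν) ∧
      (∀ μ ν, IsMc μ → IsMc ν → (d0 μ ν = 0 ↔ μ = ν)) ∧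
      (∀ μ ν, IsMc μ → IsMc ν → d0 μ ν = d0 ν μ) ∧
      (∀ μ ν ρ, IsMc μ → IsMc ν → IsMc ρ → d0 μ ρ ≤ d0 μ ν + d0 ν ρ) ∧
      (∀ μ ν, IsMcStar μ → IsMcStar ν → d0 μ ν = dM μ ν) ∧
      ((∃ m₀ > (0 : ℝ), ∃ C : ℝ, ∀ x ∈ S,
          d0 0 (ENNReal.ofReal m₀ • Measure.dirac x) ≤ C) ∨
        (∃ μ₁ μ₂, IsPc μ₁ ∧ IsPc μ₂ ∧ μ₁ ≠ μ₂ ∧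
          Filter.Tendsto (fun m : ℝ => d0 0 (ENNReal.ofReal m • μ₁))
            (nhdsWithin 0 (Set.Ioi 0)) (nhds 0) ∧
          Filter.Tendsto (fun m : ℝ => d0 0 (ENNReal.ofReal m • μ₂))
            (nhdsWithin 0 (Set.Ioi 0)) (nhds 0))) := by
  have far : ∃ x ∈ S, ∀ R : ℝ, ∃ y ∈ S, R < dist x y := by
    have hne : S.Nonempty := by
      by_contra h
      rw [Set.not_nonempty_iff_eq_empty] at h
      exact hS (h ▸ Bornology.isBounded_empty)
    obtain ⟨x, hx⟩ := hne
    refine ⟨x, hx, fun R => ?_⟩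
    by_contra! h
    refine hS ((Metric.isBounded_iff_subset_closedBall x).2 ⟨R, fun y hy => ?_⟩)
    rw [Metric.mem_closedBall, dist_comm]
    exact h y hy
  obtain ⟨x, hx, far⟩ := far
  have hd : ∀ m : ℝ, 0 < m → ∀ y z, dM (ENNReal.ofReal m • Measure.dirac y)
      (ENNReal.ofReal m • Measure.dirac z) = f m * dist y z := fun m hm y z => by
    rw [hfiber m hm _ _ (isPc_dirac y) (isPc_dirac z), Wp_dirac hp]
  have st : ∀ m : ℝ, 0 < m → ∀ y : EuclideanSpace ℝ (Fin n),
      IsMcStar (ENNReal.ofReal m • Measure.dirac y) := fun m hm y => (isPc_dirac y).star hm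
  rintro ⟨d0, -, -, dsymm, dtri, dext, h | h⟩
  · obtain ⟨m, hm, C, hC⟩ := h
    obtain ⟨y, hy, hR⟩ := far (2 * C / f m)
    have h1 := dtri _ 0 _ (st m hm x).mc isMc_zero (st m hm y).mc
    rw [dext _ _ (st m hm x) (st m hm y), hd m hm, dsymm _ 0 (st m hm x).mc isMc_zero] at h1
    have h2 := hC x hx
    have h3 := hC y hy
    rw [div_lt_iff₀ (hf m hm)] at hR
    linarith
  · obtain ⟨μ₁, μ₂, hμ₁, hμ₂, hne, t1, t2⟩ := h
    have step : ∀ m₀ : ℝ, 0 < m₀ → ∃ r > (0 : ℝ), ∀ m : ℝ, 0 < m →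
        m ∈ Set.Ioo (m₀ - r) (m₀ + r) → f m = f m₀ := by
      intro m₀ hm₀
      obtain ⟨r, hr, C, hC, H⟩ := hii m₀ hm₀
      refine ⟨r, hr, fun m hm hmr => ?_⟩
      by_contra hfm
      have hpos : 0 < |f m - f m₀| := abs_pos.2 (sub_ne_zero.2 hfm)
      obtain ⟨y, hy, hR⟩ := far (2 * C / |f m - f m₀|)
      rw [div_lt_iff₀ hpos] at hR
      have a1 := H m hm hmr x hx
      have a2 := H m hm hmr y hy
      have s1 := hsymm _ _ (st m₀ hm₀ x) (st m hm x)
      have s2 := hsymm _ _ (st m₀ hm₀ y) (st m hm y)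
      have b1 := htri _ _ _ (st m₀ hm₀ x) (st m hm x) (st m₀ hm₀ y)
      have b2 := htri _ _ _ (st m hm x) (st m hm y) (st m₀ hm₀ y)
      have b3 := htri _ _ _ (st m hm x) (st m₀ hm₀ x) (st m hm y)
      have b4 := htri _ _ _ (st m₀ hm₀ x) (st m₀ hm₀ y) (st m hm y)
      have e1 := hd m hm x y
      have e2 := hd m₀ hm₀ x y
      rcases abs_cases (f m - f m₀) with ⟨h, -⟩ | ⟨h, -⟩ <;> rw [h] at hR <;> nlinarith
    have hconst : ∀ m : ℝ, 0 < m → f m = f 1 := by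
      have hl : IsLocallyConstant (fun m : Set.Ioi (0 : ℝ) => f m) := by
        rw [IsLocallyConstant.iff_eventually_eq]
        rintro ⟨m₀, hm₀⟩
        obtain ⟨r, hr, H⟩ := step m₀ hm₀
        have : ∀ᶠ m in nhds m₀, m ∈ Set.Ioo (m₀ - r) (m₀ + r) :=
          Ioo_mem_nhds (by linarith) (by linarith)
        have := (continuous_subtype_val (p := fun m : ℝ => m ∈ Set.Ioi (0 : ℝ))).continuousAt
          (x := ⟨m₀, hm₀⟩) |>.eventually this
        filter_upwards [this] with m h
        exact H m m.2 h
      have : PreconnectedSpace (Set.Ioi (0 : ℝ)) :=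
        Subtype.preconnectedSpace isPreconnected_Ioi
      intro m hm
      exact hl.apply_eq_of_preconnectedSpace ⟨m, hm⟩ ⟨1, Set.mem_Ioi.2 one_pos⟩
    have hle : f 1 * Wp n p μ₁ μ₂ ≤ 0 := by
      have t := t1.add t2
      rw [add_zero] at t
      refine ge_of_tendsto t ?_
      filter_upwards [self_mem_nhdsWithin] with m hm
      have hm : 0 < m := hm
      have h1 := dtri _ 0 _ (hμ₁.star hm).mc isMc_zero (hμ₂.star hm).mc
      rw [dext _ _ (hμ₁.star hm) (hμ₂.star hm), hfiber m hm _ _ hμ₁ hμ₂, hconst m hm,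
        dsymm _ 0 (hμ₁.star hm).mc isMc_zero] at h1
      exact h1
    have h1 := hfiber 1 one_pos _ _ hμ₁ hμ₂
    have hs1 := hμ₁.star one_pos
    have hs2 := hμ₂.star one_pos
    have h0 := hnonneg _ _ hs1 hs2
    have := (heq _ _ hs1 hs2).1 (le_antisymm (h1 ▸ hle) h0)
    simp at this
    exact hne this
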